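/- arXiv:2412.10375 — 3 statements merged into one kernel-verified Lean document; each statement's English description precedes it below -/
import Mathlib

section
/- Let A ∈ M_n(ℝ₊) and let B ∈ M_m(ℝ₊) be a principal submatrix of A, i.e., B is obtained from A by selecting the rows and columns with indices i₁ < i₂ < … < i_m. Then for every 1 ≤ k ≤ m, Λ_k^max(B) ⊆ Λ_k^max(A). -/
open Matrix

namespace MaxAlg

variable {I J K : Type*}

/-- Entrywise nonnegative matrix (matrix over `ℝ₊`). -/
def Nonneg (A : Matrix I J ℝ) : Prop := ∀ i j, 0 ≤ A i j

/-- Max-algebra matrix product: `(A ⊗ B) i k = max_j (A i j * B j k)`. -/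
noncomputable def maxMul [Fintype J] (A : Matrix I J ℝ) (B : Matrix J K ℝ) :
    Matrix I K ℝ :=
  Matrix.of fun i k => ⨆ j, A i j * B j k

/-- Max trace: `tr_⊗(M) = max_i M i i`. -/
noncomputable def maxTrace (M : Matrix I I ℝ) : ℝ := ⨆ i, M i i

/-- Max isometry: a nonnegative matrix `X` with `Xᵗ ⊗ X = I`. -/
def IsMaxIsometry [Fintype I] [Fintype J] [DecidableEq J] (X : Matrix I J ℝ) : Prop :=
  Nonneg X ∧ maxMul Xᵀ X = 1

/-- Max numerical range `W_max(A) = {xᵗ⊗A⊗x : x ∈ ℝ₊ⁿ, xᵗ⊗x = 1}`,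
vectors being treated as `n × 1` matrices. -/
noncomputable def WMax [Fintype I] (A : Matrix I I ℝ) : Set ℝ :=
  {r | ∃ x : Matrix I (Fin 1) ℝ, Nonneg x ∧ maxMul xᵀ x = 1 ∧
    r = maxMul xᵀ (maxMul A x) 0 0}

/-- Max rank-`k` numerical range
`Λ_k^max(A) = {λ ∈ ℝ₊ : Xᵗ⊗A⊗X = λ I_k for some max isometry X}`. -/
noncomputable def LambdaMax [Fintype I] (k : ℕ) (A : Matrix I I ℝ) : Set ℝ :=
  {lam | 0 ≤ lam ∧ ∃ X : Matrix I (Fin k) ℝ, IsMaxIsometry X ∧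
    maxMul Xᵀ (maxMul A X) = lam • (1 : Matrix (Fin k) (Fin k) ℝ)}

/-- Max `k`-numerical range `W_max^k(A) = {tr_⊗(Xᵗ⊗A⊗X) : X ∈ 𝒳_{n×k}}`. -/
noncomputable def WMaxK [Fintype I] (k : ℕ) (A : Matrix I I ℝ) : Set ℝ :=
  {r | ∃ X : Matrix I (Fin k) ℝ, IsMaxIsometry X ∧
    r = maxTrace (maxMul Xᵀ (maxMul A X))}

/-- Max joint `k`-numerical range of an `m`-tuple of matrices. -/
noncomputable def WMaxKJoint [Fintype I] {m : ℕ} (k : ℕ)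
    (A : Fin m → Matrix I I ℝ) : Set (Fin m → ℝ) :=
  {v | ∃ X : Matrix I (Fin k) ℝ, IsMaxIsometry X ∧
    ∀ l, v l = maxTrace (maxMul Xᵀ (maxMul (A l) X))}

/-- Sup-norm of a real matrix: maximum absolute value of an entry. -/
noncomputable def matNorm (M : Matrix I J ℝ) : ℝ := ⨆ i, ⨆ j, |M i j|

/-- Sup-norm of a real vector: maximum absolute value of an entry. -/
noncomputable def vecNorm (v : I → ℝ) : ℝ := ⨆ i, |v i|

/-- Entrywise maximum (`max sum`) of two matrices. -/
def maxAdd (A B : Matrix I J ℝ) : Matrix I J ℝ :=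
  Matrix.of fun i j => max (A i j) (B i j)

/-- Max joint `c`-numerical range of an `m`-tuple of matrices:
`{(max_i c_i (xᵢᵗ⊗A₁⊗xᵢ), …) : X = [x₁,…,xₙ] max unitary}`; note that
`xᵢᵗ⊗A⊗xᵢ` is the `(i,i)` entry of `Xᵗ⊗A⊗X`. -/
noncomputable def WMaxCJoint {n m : ℕ} (c : Fin n → ℝ)
    (A : Fin m → Matrix (Fin n) (Fin n) ℝ) : Set (Fin m → ℝ) :=
  {v | ∃ U : Matrix (Fin n) (Fin n) ℝ, IsMaxIsometry U ∧
    ∀ l, v l = ⨆ i, c i * maxMul Uᵀ (maxMul (A l) U) i i}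

/-- Max joint `C`-numerical range of an `m`-tuple of matrices:
`{(tr_⊗(C⊗Xᵗ⊗A₁⊗X), …) : X max unitary}`. -/
noncomputable def WMaxBigCJoint {n m : ℕ} (C : Matrix (Fin n) (Fin n) ℝ)
    (A : Fin m → Matrix (Fin n) (Fin n) ℝ) : Set (Fin m → ℝ) :=
  {v | ∃ X : Matrix (Fin n) (Fin n) ℝ, IsMaxIsometry X ∧
    ∀ l, v l = maxTrace (maxMul C (maxMul Xᵀ (maxMul (A l) X)))}

/-- A nonnegative function vanishing off the range of `f` has the same supremum as its
composition with `f`. -/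
theorem iSup_eq_iSup_comp [Finite I] [Finite J] (f : J → I) (g : I → ℝ)
    (hg : ∀ i, 0 ≤ g i) (hz : ∀ i, i ∉ Set.range f → g i = 0) :
    ⨆ i, g i = ⨆ a, g (f a) := by
  apply le_antisymm
  · refine Real.iSup_le (fun i => ?_) (Real.iSup_nonneg fun a => hg (f a))
    by_cases hi : i ∈ Set.range f
    · obtain ⟨a, rfl⟩ := hi
      exact le_ciSup (f := fun a => g (f a)) (Set.finite_range _).bddAbove a
    · rw [hz i hi]
      exact Real.iSup_nonneg fun a => hg (f a)
  · exact Real.iSup_le (fun a => le_ciSup (Set.finite_range g).bddAbove (f a))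
      (Real.iSup_nonneg hg)

theorem Nonneg.maxMul [Fintype J] {A : Matrix I J ℝ} {B : Matrix J K ℝ}
    (hA : Nonneg A) (hB : Nonneg B) : Nonneg (maxMul A B) :=
  fun i k => Real.iSup_nonneg fun j => mul_nonneg (hA i j) (hB j k)

/-- If all products `A i j * B j k` with `j` outside the range of `f` vanish, then the max
product of `A` and `B` only involves the indices in the range of `f`. -/
theorem maxMul_eq_maxMul_submatrix {L : Type*} [Fintype J] [Fintype L] (f : L → J)
    {A : Matrix I J ℝ} {B : Matrix J K ℝ} (hA : Nonneg A) (hB : Nonneg B)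
    (hz : ∀ i j k, j ∉ Set.range f → A i j * B j k = 0) :
    maxMul A B = maxMul (A.submatrix id f) (B.submatrix f id) := by
  ext i k
  exact iSup_eq_iSup_comp f (fun j => A i j * B j k)
    (fun j => mul_nonneg (hA i j) (hB j k)) (fun j hj => hz i j k hj)

/-- for a principal submatrix `B = A.submatrix f f` (indices `i₁ < … < i_m`),
`Λ_k^max(B) ⊆ Λ_k^max(A)` for every `1 ≤ k ≤ m`. -/
theorem lambdaMax_submatrix_subset {n m : ℕ} (A : Matrix (Fin n) (Fin n) ℝ)
    (hA : Nonneg A) (f : Fin m → Fin n) (hf : StrictMono f)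
    {k : ℕ} (hk1 : 1 ≤ k) (hkm : k ≤ m) :
    LambdaMax k (A.submatrix f f) ⊆ LambdaMax k A := by
  rintro lam ⟨hlam, X, ⟨hX, hXX⟩, hXAX⟩
  let Y : Matrix (Fin n) (Fin k) ℝ := fun i c => Function.extend f (fun a => X a c) 0 i
  have hYf : Y.submatrix f id = X := by
    ext a c
    exact hf.injective.extend_apply (fun a => X a c) 0 a
  have hYz : ∀ i, i ∉ Set.range f → ∀ c, Y i c = 0 := fun i hi c =>
    Function.extend_apply' _ _ _ hi
  have hY : Nonneg Y := fun i c => by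
    by_cases hi : i ∈ Set.range f
    · obtain ⟨a, rfl⟩ := hi
      exact (hX a c).trans_eq (congrFun (congrFun hYf a) c).symm
    · exact (hYz i hi c).ge
  have hYt : Nonneg Yᵀ := fun c i => hY i c
  have hYtf : Yᵀ.submatrix id f = Xᵀ := by rw [← hYf]; rfl
  refine ⟨hlam, Y, ⟨hY, ?_⟩, ?_⟩
  · rw [maxMul_eq_maxMul_submatrix f hYt hY fun i j c hj => by simp [hYz j hj], hYf, hYtf, hXX]
  · have hAY : (maxMul A Y).submatrix f id = maxMul (A.submatrix f f) X := by
      rw [maxMul_eq_maxMul_submatrix f hA hY fun i j c hj => by simp [hYz j hj], hYf]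
      rfl
    rw [maxMul_eq_maxMul_submatrix f hYt (hA.maxMul hY) fun i j c hj => by simp [hYz j hj],
      hAY, hYtf, hXAX]

end MaxAlg
end

section
/- Let A = (a_{ij}) ∈ M_n(ℝ₊) and let 1 ≤ k < n. Then W_max^k(A) = [c, d] ⊆ ℝ₊, where c = min{ max_{1≤j≤k} a_{i_j i_j} : 1 ≤ i₁ < i₂ < … < i_k ≤ n } and d = max_{1≤i,j≤n} a_{ij}. Moreover, W_max^n(A) = { max_{1≤i≤n} a_{ii} }. -/
open Matrix

namespace MaxAlg

variable {I J K : Type*}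

theorem continuous_iSup_of_finite {ι α : Type*} [Finite ι] [TopologicalSpace α]
    {f : ι → α → ℝ} (hf : ∀ i, Continuous (f i)) : Continuous fun x => ⨆ i, f i x := by
  cases nonempty_fintype ι
  cases isEmpty_or_nonempty ι
  · simpa only [Real.iSup_of_isEmpty] using continuous_const
  · simp only [← Finset.sup'_univ_eq_ciSup]
    exact Continuous.finset_sup'_apply _ fun i _ => hf i

theorem le_iSup_of_finite {ι : Type*} [Finite ι] (f : ι → ℝ) (i : ι) : f i ≤ ⨆ i, f i :=
  le_ciSup (Set.finite_range f).bddAbove i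

theorem continuous_maxTrace_compression [Fintype I] [Finite J] (A : Matrix I I ℝ) :
    Continuous fun X : Matrix I J ℝ => maxTrace (maxMul Xᵀ (maxMul A X)) := by
  refine continuous_iSup_of_finite fun j => continuous_iSup_of_finite fun r => ?_
  refine Continuous.mul (by simp only [transpose_apply]; fun_prop) ?_
  exact continuous_iSup_of_finite fun s => by fun_prop

theorem le_maxTrace_compression [Fintype I] [Finite J] (A : Matrix I I ℝ) {X : Matrix I J ℝ}
    (hX : Nonneg X) (r s : I) (j : J) :
    X r j * (A r s * X s j) ≤ maxTrace (maxMul Xᵀ (maxMul A X)) := by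
  refine le_trans ?_ (le_iSup_of_finite _ j)
  refine le_trans ?_ (le_iSup_of_finite _ r)
  exact mul_le_mul_of_nonneg_left (le_iSup_of_finite (fun s => A r s * X s j) s) (hX r j)

theorem maxTrace_compression_le [Fintype I] (A : Matrix I I ℝ) {X : Matrix I J ℝ}
    (hX : Nonneg X) {b : ℝ} (hb : 0 ≤ b) (h : ∀ r s j, X r j * (A r s * X s j) ≤ b) :
    maxTrace (maxMul Xᵀ (maxMul A X)) ≤ b := by
  refine Real.iSup_le (fun j => Real.iSup_le (fun r => ?_) hb) hb
  change X r j * (⨆ s, A r s * X s j) ≤ b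
  rw [Real.mul_iSup_of_nonneg (hX r j)]
  exact Real.iSup_le (fun s => h r s j) hb

/-- A max isometry is a nonnegative matrix with entries at most `1`, each column attaining `1`,
and at most one nonzero entry in each row. -/
theorem isMaxIsometry_iff [Fintype I] [Fintype J] [DecidableEq J] {X : Matrix I J ℝ} :
    IsMaxIsometry X ↔ Nonneg X ∧ (∀ i j, X i j ≤ 1) ∧ (∀ j, ∃ i, X i j = 1) ∧
      ∀ i j j', j ≠ j' → X i j * X i j' = 0 := by
  refine and_congr_right fun hX => ⟨fun h => ?_, fun ⟨hle, hone, horth⟩ => ?_⟩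
  · have hentry : ∀ j j', ⨆ i, X i j * X i j' = (1 : Matrix J J ℝ) j j' := fun j j' =>
      congrFun (congrFun h j) j'
    have hle : ∀ i j, X i j ≤ 1 := fun i j => by
      have h1 := le_iSup_of_finite (fun i => X i j * X i j) i
      rw [hentry, one_apply_eq] at h1
      nlinarith [hX i j]
    refine ⟨hle, fun j => ?_, fun i j j' hj => ?_⟩
    · have h1 := hentry j j
      rw [one_apply_eq] at h1
      have : Nonempty I := by
        by_contra hI
        rw [not_nonempty_iff] at hI
        rw [Real.iSup_of_isEmpty] at h1
        exact zero_ne_one h1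
      obtain ⟨i, hi⟩ := exists_eq_ciSup_of_finite (f := fun i => X i j * X i j)
      rw [h1] at hi
      refine ⟨i, ?_⟩
      nlinarith [hX i j, hle i j]
    · have h1 := le_iSup_of_finite (fun i => X i j * X i j') i
      rw [hentry, one_apply_ne hj] at h1
      exact le_antisymm h1 (mul_nonneg (hX i j) (hX i j'))
  · ext j j'
    change ⨆ i, X i j * X i j' = _
    obtain rfl | hj := eq_or_ne j j'
    · rw [one_apply_eq]
      obtain ⟨i, hi⟩ := hone j
      refine le_antisymm (Real.iSup_le (fun i => ?_) zero_le_one) ?_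
      · exact mul_le_one₀ (hle i j) (hX i j) (hle i j)
      · simpa [hi] using le_iSup_of_finite (fun i => X i j * X i j) i
    · simp [one_apply_ne hj, horth _ _ _ hj]

theorem IsMaxIsometry.exists_injective [Fintype I] [Fintype J] [DecidableEq J]
    {X : Matrix I J ℝ} (hX : IsMaxIsometry X) :
    ∃ u : J → I, Function.Injective u ∧ ∀ j, X (u j) j = 1 := by
  obtain ⟨-, -, hone, horth⟩ := isMaxIsometry_iff.1 hX
  choose u hu using hone
  refine ⟨u, fun j j' h => ?_, hu⟩
  by_contra hj
  have h0 := horth (u j) j j' hj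
  rw [hu, h, hu] at h0
  norm_num at h0

/-- The `0`-`1` matrix whose row `i` is the `g i`-th unit vector, or zero if `g i = none`. -/
def partialMatrix [DecidableEq J] (g : I → Option J) : Matrix I J ℝ :=
  Matrix.of fun i j => if g i = some j then 1 else 0

/-- Every value in `J` is attained by the partial function `g`. -/
def Covers (g : I → Option J) : Prop := ∀ j, ∃ i, g i = some j

theorem nonneg_partialMatrix [DecidableEq J] (g : I → Option J) : Nonneg (partialMatrix g) :=
  fun i j => by simp only [partialMatrix, of_apply]; split_ifs <;> norm_num

theorem Covers.update [DecidableEq I] {g : I → Option J} (hg : Covers g) {r : I}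
    (hr : g r = none) (o : Option J) : Covers (Function.update g r o) := fun j => by
  obtain ⟨i, hi⟩ := hg j
  refine ⟨i, ?_⟩
  rw [Function.update_of_ne, hi]
  rintro rfl
  simp [hr] at hi

theorem segment_partialMatrix_update [Fintype I] [Fintype J] [DecidableEq I] [DecidableEq J]
    {g : I → Option J} (hg : Covers g) {r : I} (hr : g r = none) (j : J) :
    segment ℝ (partialMatrix g) (partialMatrix (Function.update g r (some j))) ⊆
      {X | IsMaxIsometry X} := by
  rintro _ ⟨a, b, ha, hb, hab, rfl⟩
  have hentry : ∀ i l, (a • partialMatrix g +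
      b • partialMatrix (Function.update g r (some j))) i l =
      if g i = some l then 1 else if i = r ∧ j = l then b else 0 := fun i l => by
    obtain rfl | hi := eq_or_ne i r
    · by_cases hl : j = l <;> simp [partialMatrix, hr, hl]
    · by_cases hl : g i = some l <;> simp [partialMatrix, hi, hl, hab]
  refine isMaxIsometry_iff.2 ⟨fun i l => ?_, fun i l => ?_, fun l => ?_, fun i l l' hl => ?_⟩
  · rw [hentry]; split_ifs <;> linarith
  · rw [hentry]; split_ifs <;> linarith
  · obtain ⟨i, hi⟩ := hg l
    exact ⟨i, by rw [hentry, if_pos hi]⟩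
  · rw [hentry, hentry]
    obtain rfl | hi := eq_or_ne i r
    · by_cases h1 : j = l <;> by_cases h2 : j = l' <;> simp_all
    · by_cases h1 : g i = some l <;> by_cases h2 : g i = some l' <;> simp_all

theorem joinedIn_partialMatrix_update [Fintype I] [Fintype J] [DecidableEq I] [DecidableEq J]
    {g : I → Option J} (hg : Covers g) {r : I} (hr : g r = none) (j : J) :
    JoinedIn {X | IsMaxIsometry X} (partialMatrix g)
      (partialMatrix (Function.update g r (some j))) :=
  JoinedIn.of_segment_subset (segment_partialMatrix_update hg hr j)

/-- If some row of a `0`-`1` max isometry vanishes, then within the max isometries it can be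
moved to one having entries `1` at rows `p` and `q` of a common column. -/
theorem exists_joinedIn_partialMatrix [Fintype I] [Fintype J] [DecidableEq I] [DecidableEq J]
    [Nonempty J] {g : I → Option J} (hg : Covers g) {r : I} (hr : g r = none) (p q : I) :
    ∃ h : I → Option J, (∃ j, h p = some j ∧ h q = some j) ∧
      JoinedIn {X | IsMaxIsometry X} (partialMatrix g) (partialMatrix h) := by
  have hfill : ∀ {g : I → Option J}, Covers g → ∀ {p q : I} {j : J},
      g p = some j → g q = none → ∃ h : I → Option J, (∃ j, h p = some j ∧ h q = some j) ∧
        JoinedIn {X | IsMaxIsometry X} (partialMatrix g) (partialMatrix h) := by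
    intro g hg p q j hp hq
    have hpq : p ≠ q := by rintro rfl; simp [hp] at hq
    exact ⟨_, ⟨j, by simp [hpq, hp], by simp⟩, joinedIn_partialMatrix_update hg hq j⟩
  obtain hp | ⟨jp, hp⟩ := Option.eq_none_or_eq_some (g p) <;>
    obtain hq | ⟨jq, hq⟩ := Option.eq_none_or_eq_some (g q)
  · obtain ⟨j⟩ := ‹Nonempty J›
    have h1 := joinedIn_partialMatrix_update hg hp j
    obtain rfl | hpq := eq_or_ne p q
    · exact ⟨_, ⟨j, by simp, by simp⟩, h1⟩
    · obtain ⟨h, hh, h2⟩ := hfill (hg.update hp (some j)) (p := p) (q := q) (j := j) (by simp)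
        (by simp [hpq.symm, hq])
      exact ⟨h, hh, h1.trans h2⟩
  · obtain ⟨h, ⟨j, h1, h2⟩, h3⟩ := hfill hg hq hp
    exact ⟨h, ⟨j, h2, h1⟩, h3⟩
  · exact hfill hg hp hq
  · obtain hpq | hpq := eq_or_ne p q
    · subst hpq
      exact ⟨g, ⟨jp, hp, hp⟩, (joinedIn_partialMatrix_update hg hr jp).trans
        (joinedIn_partialMatrix_update hg hr jp).symm⟩
    have hrp : p ≠ r := by rintro rfl; simp [hp] at hr
    have hrq : q ≠ r := by rintro rfl; simp [hq] at hr
    set g₁ := Function.update g r (some jq) with hg₁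
    set g₂ := Function.update g₁ q none with hg₂
    have hcov : Covers g₂ := fun j => by
      obtain ⟨i, hi⟩ := hg j
      by_cases hiq : i = q
      · refine ⟨r, ?_⟩
        subst hiq
        rw [hg₂, Function.update_of_ne hrq.symm, hg₁, Function.update_self, ← hq, hi]
      · have hir : i ≠ r := by rintro rfl; simp [hr] at hi
        exact ⟨i, by simp [hg₂, hg₁, hiq, hir, hi]⟩
    have hback : Function.update g₂ q (some jq) = g₁ := by
      rw [hg₂, Function.update_idem, Function.update_eq_self_iff, hg₁,
        Function.update_of_ne hrq, hq]
    have h1 := joinedIn_partialMatrix_update hg hr jq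
    have h2 := joinedIn_partialMatrix_update hcov (r := q) (by simp [hg₂]) jq
    rw [hback] at h2
    obtain ⟨h, hh, h3⟩ := hfill hcov (p := p) (q := q) (j := jp)
      (by simp [hg₂, hg₁, hpq, hrp, hp]) (by simp [hg₂])
    exact ⟨h, hh, (h1.trans h2.symm).trans h3⟩

theorem maxTrace_compression_mem_WMaxK [Fintype I] {k : ℕ} (A : Matrix I I ℝ)
    {X Y : Matrix I (Fin k) ℝ} (h : JoinedIn {X | IsMaxIsometry X} X Y) {b : ℝ}
    (hX : maxTrace (maxMul Xᵀ (maxMul A X)) ≤ b) (hY : b ≤ maxTrace (maxMul Yᵀ (maxMul A Y))) :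
    b ∈ WMaxK k A := by
  obtain ⟨γ, hγ⟩ := h
  obtain ⟨t, ht⟩ := mem_range_of_exists_le_of_exists_ge
    ((continuous_maxTrace_compression A).comp γ.continuous)
    ⟨0, by simpa using hX⟩ ⟨1, by simpa using hY⟩
  exact ⟨γ t, hγ t, ht.symm⟩

theorem maxTrace_compression_partialMatrix_le [Fintype I] [Fintype J] [DecidableEq J]
    {A : Matrix I I ℝ} (hA : Nonneg A) {f : J → I} {g : I → Option J}
    (hg : Function.IsPartialInv f g) :
    maxTrace (maxMul (partialMatrix g)ᵀ (maxMul A (partialMatrix g))) ≤ ⨆ j, A (f j) (f j) := by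
  have h0 : 0 ≤ ⨆ j, A (f j) (f j) := Real.iSup_nonneg fun j => hA _ _
  refine maxTrace_compression_le A (nonneg_partialMatrix _) h0 fun r s j => ?_
  simp only [partialMatrix, of_apply]
  by_cases hr : g r = some j
  · by_cases hs : g s = some j
    · rw [if_pos hr, if_pos hs, one_mul, mul_one, ← (hg j r).1 hr, ← (hg j s).1 hs]
      exact le_iSup_of_finite (fun j => A (f j) (f j)) j
    · simpa [hs] using h0
  · simpa [hr] using h0

theorem iInf_strictMono_le {n k : ℕ} {A : Matrix (Fin n) (Fin n) ℝ} (hA : Nonneg A)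
    {u : Fin k → Fin n} (hu : Function.Injective u) :
    (⨅ f : {f : Fin k → Fin n // StrictMono f}, ⨆ j, A (f.1 j) (f.1 j)) ≤
      ⨆ j, A (u j) (u j) := by
  have hcard : (Finset.univ.image u).card = k := by
    rw [Finset.card_image_of_injective _ hu, Finset.card_fin]
  let e := (Finset.univ.image u).orderEmbOfFin hcard
  refine (ciInf_le (Set.finite_range _).bddBelow
    (⟨e, e.strictMono⟩ : {f : Fin k → Fin n // StrictMono f})).trans ?_
  refine Real.iSup_le (fun j => ?_) (Real.iSup_nonneg fun j => hA _ _)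
  obtain ⟨l, -, hl⟩ := Finset.mem_image.1
    ((Finset.univ.image u).orderEmbOfFin_mem hcard j)
  change A (e j) (e j) ≤ _
  rw [show e j = u l from hl.symm]
  exact le_iSup_of_finite (fun j => A (u j) (u j)) l

theorem iSup_diag_le_maxTrace_compression [Fintype I] [Finite J] (A : Matrix I I ℝ)
    {X : Matrix I J ℝ} (hX : Nonneg X) {u : J → I} (hu : ∀ j, X (u j) j = 1) :
    ⨆ j, A (u j) (u j) ≤ maxTrace (maxMul Xᵀ (maxMul A X)) := by
  have hle : ∀ j, A (u j) (u j) ≤ maxTrace (maxMul Xᵀ (maxMul A X)) := fun j => by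
    simpa [hu] using le_maxTrace_compression A hX (u j) (u j) j
  cases isEmpty_or_nonempty J
  · simp [maxTrace]
  · exact ciSup_le hle

theorem WMaxK_subset_Icc {n k : ℕ} {A : Matrix (Fin n) (Fin n) ℝ} (hA : Nonneg A) :
    WMaxK k A ⊆ Set.Icc
      (⨅ f : {f : Fin k → Fin n // StrictMono f}, ⨆ j, A (f.1 j) (f.1 j))
      (⨆ i, ⨆ j, A i j) := by
  rintro _ ⟨X, hX, rfl⟩
  obtain ⟨u, hinj, hu⟩ := hX.exists_injective
  obtain ⟨hnn, hle, -, -⟩ := isMaxIsometry_iff.1 hX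
  refine ⟨(iInf_strictMono_le hA hinj).trans (iSup_diag_le_maxTrace_compression A hnn hu),
    maxTrace_compression_le A hnn
      (Real.iSup_nonneg fun i => Real.iSup_nonneg fun j => hA i j) fun r s j => ?_⟩
  calc X r j * (A r s * X s j) ≤ 1 * (A r s * 1) := by
        gcongr
        · exact mul_nonneg (hA r s) (hnn s j)
        · exact hle r j
        · exact hA r s
        · exact hle s j
    _ = A r s := by ring
    _ ≤ ⨆ s, A r s := le_iSup_of_finite (A r) s
    _ ≤ ⨆ i, ⨆ j, A i j := le_iSup_of_finite (fun i => ⨆ j, A i j) r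

theorem Icc_subset_WMaxK {n k : ℕ} {A : Matrix (Fin n) (Fin n) ℝ} (hA : Nonneg A)
    (hk1 : 1 ≤ k) (hkn : k < n) :
    Set.Icc (⨅ f : {f : Fin k → Fin n // StrictMono f}, ⨆ j, A (f.1 j) (f.1 j))
      (⨆ i, ⨆ j, A i j) ⊆ WMaxK k A := by
  rintro b ⟨hcb, hbd⟩
  have : Nonempty (Fin k) := ⟨⟨0, hk1⟩⟩
  have : Nonempty (Fin n) := ⟨⟨0, by omega⟩⟩
  have : Nonempty {f : Fin k → Fin n // StrictMono f} :=
    ⟨⟨Fin.castLE hkn.le, Fin.strictMono_castLE hkn.le⟩⟩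
  obtain ⟨⟨f, hf⟩, hfc⟩ := exists_eq_ciInf_of_finite
    (f := fun f : {f : Fin k → Fin n // StrictMono f} => ⨆ j, A (f.1 j) (f.1 j))
  obtain ⟨p, hp⟩ := exists_eq_ciSup_of_finite (f := fun i => ⨆ j, A i j)
  obtain ⟨q, hq⟩ := exists_eq_ciSup_of_finite (f := A p)
  have hinv := hf.injective.isPartialInv
  obtain ⟨r, hr⟩ : ∃ r, Function.partialInv f r = none := by
    by_contra! h
    have hsurj : Function.Surjective f := fun r => by
      obtain ⟨j, hj⟩ := Option.ne_none_iff_exists'.1 (h r)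
      exact ⟨j, (hinv j r).1 hj⟩
    have := Fintype.card_le_of_surjective f hsurj
    simp only [Fintype.card_fin] at this
    omega
  obtain ⟨h, ⟨j, hjp, hjq⟩, hjoin⟩ := exists_joinedIn_partialMatrix
    (g := Function.partialInv f) (fun j => ⟨f j, (hinv j _).2 rfl⟩) hr p q
  refine maxTrace_compression_mem_WMaxK A hjoin
    ((maxTrace_compression_partialMatrix_le hA hinv).trans (hfc.trans_le hcb)) ?_
  rw [← hp] at hbd
  refine hbd.trans (hq.symm.trans_le ?_)
  simpa [partialMatrix, hjp, hjq] using
    le_maxTrace_compression A (nonneg_partialMatrix h) p q j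

theorem isMaxIsometry_one [Fintype I] [DecidableEq I] : IsMaxIsometry (1 : Matrix I I ℝ) := by
  refine isMaxIsometry_iff.2 ⟨fun i j => ?_, fun i j => ?_, fun j => ⟨j, one_apply_eq j⟩,
    fun i j j' hj => ?_⟩
  · rw [one_apply]; split_ifs <;> norm_num
  · rw [one_apply]; split_ifs <;> norm_num
  · obtain rfl | hi := eq_or_ne i j
    · rw [one_apply_ne hj, mul_zero]
    · rw [one_apply_ne hi, zero_mul]

theorem IsMaxIsometry.maxTrace_compression_eq [Fintype I] [DecidableEq I] {A : Matrix I I ℝ}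
    (hA : Nonneg A) {X : Matrix I I ℝ} (hX : IsMaxIsometry X) :
    maxTrace (maxMul Xᵀ (maxMul A X)) = ⨆ i, A i i := by
  obtain ⟨u, hinj, hu⟩ := hX.exists_injective
  obtain ⟨hnn, -, -, horth⟩ := isMaxIsometry_iff.1 hX
  have hsurj : Function.Surjective u := Finite.surjective_of_injective hinj
  have hzero : ∀ r j, r ≠ u j → X r j = 0 := fun r j hr => by
    obtain ⟨l, rfl⟩ := hsurj r
    have h := horth (u l) l j (fun h => hr (congrArg u h))
    rwa [hu, one_mul] at h
  have h0 : 0 ≤ ⨆ i, A i i := Real.iSup_nonneg fun i => hA i i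
  apply le_antisymm
  · refine maxTrace_compression_le A hnn h0 fun r s j => ?_
    by_cases hr : r = u j
    · by_cases hs : s = u j
      · subst hr hs
        simpa [hu] using le_iSup_of_finite (fun i => A i i) (u j)
      · simpa [hzero s j hs] using h0
    · simpa [hzero r j hr] using h0
  · rw [← hsurj.iSup_comp fun i => A i i]
    exact iSup_diag_le_maxTrace_compression A hnn hu

/-- `W_max^k(A) = [c, d]` for `1 ≤ k < n`, where `c` is the minimum over
strictly increasing `k`-tuples of the max of the selected diagonal entries and
`d = max_{i,j} a_ij`; moreover `W_max^n(A) = {max_i a_ii}`. -/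
theorem wmaxK_eq_Icc {n : ℕ} (A : Matrix (Fin n) (Fin n) ℝ) (hA : Nonneg A)
    {k : ℕ} (hk1 : 1 ≤ k) (hkn : k < n) :
    WMaxK k A = Set.Icc
        (⨅ f : {f : Fin k → Fin n // StrictMono f}, ⨆ j, A (f.1 j) (f.1 j))
        (⨆ i, ⨆ j, A i j) ∧
    WMaxK n A = {⨆ i, A i i} := by
  refine ⟨(WMaxK_subset_Icc hA).antisymm (Icc_subset_WMaxK hA hk1 hkn), ?_⟩
  refine Set.Subset.antisymm ?_ ?_
  · rintro _ ⟨X, hX, rfl⟩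
    exact hX.maxTrace_compression_eq hA
  · rintro _ rfl
    exact ⟨1, isMaxIsometry_one, (isMaxIsometry_one.maxTrace_compression_eq hA).symm⟩

end MaxAlg
end

section
/- Let 𝔸 = (A₁, …, A_m) with A_i ∈ M_n(ℝ₊) for i = 1, …, m, let 1 ≤ k ≤ n, and define f_𝔸 : 𝒳_{n×k} → ℝ₊^m by f_𝔸(X) = (tr_⊗(Xᵗ⊗A₁⊗X), …, tr_⊗(Xᵗ⊗A_m⊗X)). Then for every Z ∈ 𝒳_{n×k} and all X, Y ∈ 𝒳_{n×k} with ‖X − Z‖ ≤ 1/2 and ‖Y − Z‖ ≤ 1/2, one has ‖f_𝔸(X) − f_𝔸(Y)‖ ≤ ‖⊕_{i=1}^{m} A_i‖ · (2‖Z‖ + 1) · ‖X − Y‖, where the differences are taken in ℝ and ‖·‖ denotes the maximum of the absolute values of the entries, and ⊕_{i=1}^{m} A_i is the entrywise maximum of A₁, …, A_m. -/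
open Matrix

namespace MaxAlg

variable {I J K : Type*}

theorem abs_le_matNorm [Finite I] [Finite J] (M : Matrix I J ℝ) (i : I) (j : J) :
    |M i j| ≤ matNorm M :=
  (le_ciSup (f := fun j => |M i j|) (Set.finite_range _).bddAbove j).trans
    (le_ciSup (f := fun i => ⨆ j, |M i j|) (Set.finite_range _).bddAbove i)

theorem matNorm_nonneg (M : Matrix I J ℝ) : 0 ≤ matNorm M :=
  Real.iSup_nonneg fun _ => Real.iSup_nonneg fun _ => abs_nonneg _

theorem le_matNorm_iSup [Finite I] [Finite J] [Finite K] (A : K → Matrix I J ℝ)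
    (l : K) (i : I) (j : J) :
    A l i j ≤ matNorm (Matrix.of fun i j => ⨆ l, A l i j) :=
  (le_ciSup (f := fun l => A l i j) (Set.finite_range _).bddAbove l).trans
    ((le_abs_self _).trans (abs_le_matNorm (Matrix.of fun i j => ⨆ l, A l i j) i j))

theorem mul_le_maxTrace [Fintype I] [Finite J] {X : Matrix I J ℝ} (hX : Nonneg X)
    (A : Matrix I I ℝ) (i : J) (p q : I) :
    X p i * (A p q * X q i) ≤ maxTrace (maxMul Xᵀ (maxMul A X)) :=
  calc
    X p i * (A p q * X q i) ≤ X p i * ⨆ q, A p q * X q i :=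
      mul_le_mul_of_nonneg_left
        (le_ciSup (f := fun q => A p q * X q i) (Set.finite_range _).bddAbove q) (hX p i)
    _ ≤ ⨆ p, X p i * ⨆ q, A p q * X q i :=
      le_ciSup (f := fun p => X p i * ⨆ q, A p q * X q i) (Set.finite_range _).bddAbove p
    _ ≤ maxTrace (maxMul Xᵀ (maxMul A X)) :=
      le_ciSup (f := fun i => maxMul Xᵀ (maxMul A X) i i) (Set.finite_range _).bddAbove i

theorem maxTrace_le [Fintype I] {X : Matrix I J ℝ} (hX : Nonneg X) {A : Matrix I I ℝ} {C : ℝ}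
    (hC : 0 ≤ C) (h : ∀ i p q, X p i * (A p q * X q i) ≤ C) :
    maxTrace (maxMul Xᵀ (maxMul A X)) ≤ C := by
  refine Real.iSup_le (fun i => Real.iSup_le (fun p => ?_) hC) hC
  change X p i * ⨆ q, A p q * X q i ≤ C
  rw [Real.mul_iSup_of_nonneg (hX p i)]
  exact Real.iSup_le (h i p) hC

theorem maxTrace_nonneg [Fintype I] {X : Matrix I J ℝ} (hX : Nonneg X) {A : Matrix I I ℝ}
    (hA : Nonneg A) : 0 ≤ maxTrace (maxMul Xᵀ (maxMul A X)) :=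
  Real.iSup_nonneg fun i => Real.iSup_nonneg fun p =>
    mul_nonneg (hX p i) (Real.iSup_nonneg fun q => mul_nonneg (hA p q) (hX q i))

theorem maxTrace_le_add [Fintype I] [Finite J] {X Y : Matrix I J ℝ} {A : Matrix I I ℝ}
    {a b c : ℝ} (hX : Nonneg X) (hY : Nonneg Y) (hA : Nonneg A)
    (ha : 0 ≤ a) (hb : 0 ≤ b) (hc : 0 ≤ c)
    (hAa : ∀ p q, A p q ≤ a) (hXb : ∀ p i, X p i ≤ b) (hYb : ∀ p i, Y p i ≤ b)
    (hXY : ∀ p i, X p i - Y p i ≤ c) :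
    maxTrace (maxMul Xᵀ (maxMul A X)) ≤
      maxTrace (maxMul Yᵀ (maxMul A Y)) + a * (2 * b * c) := by
  refine maxTrace_le hX (add_nonneg (maxTrace_nonneg hY hA) (by positivity)) fun i p q => ?_
  have h₁ : X p i * (X q i - Y q i) ≤ b * c :=
    (mul_le_mul_of_nonneg_left (hXY q i) (hX p i)).trans
      (mul_le_mul_of_nonneg_right (hXb p i) hc)
  have h₂ : Y q i * (X p i - Y p i) ≤ b * c :=
    (mul_le_mul_of_nonneg_left (hXY p i) (hY q i)).trans
      (mul_le_mul_of_nonneg_right (hYb q i) hc)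
  calc
    X p i * (A p q * X q i) = Y p i * (A p q * Y q i) +
        A p q * (X p i * (X q i - Y q i) + Y q i * (X p i - Y p i)) := by ring
    _ ≤ Y p i * (A p q * Y q i) + A p q * (2 * b * c) := by
      gcongr
      · exact hA p q
      · linarith
    _ ≤ maxTrace (maxMul Yᵀ (maxMul A Y)) + a * (2 * b * c) := by
      gcongr
      · exact mul_le_maxTrace hY A i p q
      · exact hAa p q

/-- local Lipschitz bound near a max isometry `Z`:
`‖f_𝔸(X) − f_𝔸(Y)‖ ≤ ‖⊕ᵢ Aᵢ‖ (2‖Z‖ + 1) ‖X − Y‖` whenever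
`‖X − Z‖ ≤ 1/2` and `‖Y − Z‖ ≤ 1/2`. -/
theorem joint_trace_local_lipschitz {n m k : ℕ} (hm : 0 < m) (hk1 : 1 ≤ k) (hkn : k ≤ n)
    (A : Fin m → Matrix (Fin n) (Fin n) ℝ) (hA : ∀ l, Nonneg (A l))
    (Z X Y : Matrix (Fin n) (Fin k) ℝ)
    (hZ : IsMaxIsometry Z) (hX : IsMaxIsometry X) (hY : IsMaxIsometry Y)
    (hXZ : matNorm (X - Z) ≤ 1 / 2) (hYZ : matNorm (Y - Z) ≤ 1 / 2) :
    vecNorm (fun l => maxTrace (maxMul Xᵀ (maxMul (A l) X)) -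
                      maxTrace (maxMul Yᵀ (maxMul (A l) Y)))
      ≤ matNorm (Matrix.of fun i j => ⨆ l, A l i j) *
          ((2 * matNorm Z + 1) * matNorm (X - Y)) := by
  set a := matNorm (Matrix.of fun i j => ⨆ l, A l i j)
  have ha : 0 ≤ a := matNorm_nonneg _
  have hz : 0 ≤ matNorm Z := matNorm_nonneg Z
  have hc : 0 ≤ matNorm (X - Y) := matNorm_nonneg _
  have hb : 0 ≤ matNorm Z + 1 / 2 := by linarith
  have entry_le : ∀ W : Matrix (Fin n) (Fin k) ℝ, matNorm (W - Z) ≤ 1 / 2 →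
      ∀ p i, W p i ≤ matNorm Z + 1 / 2 := fun W hW p i => by
    have h₁ : W p i - Z p i ≤ matNorm (W - Z) :=
      (le_abs_self _).trans (abs_le_matNorm (W - Z) p i)
    have h₂ := (le_abs_self _).trans (abs_le_matNorm Z p i)
    linarith
  have hXY : ∀ p i, |X p i - Y p i| ≤ matNorm (X - Y) := abs_le_matNorm (X - Y)
  have two_mul_bound : 2 * matNorm Z + 1 = 2 * (matNorm Z + 1 / 2) := by ring
  rw [two_mul_bound]
  refine Real.iSup_le (fun l => abs_le.2 ⟨?_, ?_⟩) (by positivity)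
  · have := maxTrace_le_add hY.1 hX.1 (hA l) ha hb hc (le_matNorm_iSup A l)
      (entry_le Y hYZ) (entry_le X hXZ)
      fun p i => (le_abs_self _).trans ((abs_sub_comm _ _).trans_le (hXY p i))
    linarith
  · have := maxTrace_le_add hX.1 hY.1 (hA l) ha hb hc (le_matNorm_iSup A l)
      (entry_le X hXZ) (entry_le Y hYZ) fun p i => (le_abs_self _).trans (hXY p i)
    linarith

end MaxAlg
end
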